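/- arXiv:1811.08130 — 2 statements merged into one kernel-verified Lean document; each statement's English description precedes it below -/
import Mathlib

section
/- Let 0 < δ₁ < δ₀, and let χ ∈ C^∞(ℝ, [0,1]) satisfy χ(x) = 1 for |x| ≤ δ₁ and χ(x) = 0 for |x| ≥ δ₀. Let n ≥ 2 be an integer, C > 0, and let f ∈ C³(ℝ, ℂ) satisfy |f^{(j)}(ω)| ≤ C ⟨ω⟩^{−n−j} for j = 0, 1, 2, 3 and all ω ∈ ℝ. Then there exists C' > 0, depending only on χ, n, and C, such that for all ρ ∈ (0,1) and all a ∈ ℝ \ {0}: | ρ^{−n} ∫_ℝ (1 − χ(ρ⟨ω⟩)) e^{i a ω} f(ω) dω | ≤ C' |a|^{−1} ⟨a⟩^{−2}. -/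
open MeasureTheory Set

/-- If `χ` is smooth and constant on `[-δ, δ]`, then `χ ∘ √` is smooth. -/
lemma contDiff_comp_sqrt_of_eq_one {χ : ℝ → ℝ} {δ : ℝ} {N : WithTop ℕ∞} (hδ : 0 < δ)
    (hχ : ContDiff ℝ N χ) (hone : ∀ x : ℝ, |x| ≤ δ → χ x = 1) :
    ContDiff ℝ N (fun s => χ (√s)) := by
  rw [contDiff_iff_contDiffAt]
  intro s
  rcases lt_or_ge s (δ ^ 2) with hs | hs
  · refine (contDiffAt_const (c := (1 : ℝ))).congr_of_eventuallyEq ?_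
    filter_upwards [Iio_mem_nhds hs] with x hx
    apply hone
    rw [abs_of_nonneg (Real.sqrt_nonneg _)]
    exact (Real.sqrt_le_left hδ.le).2 (le_of_lt hx)
  · exact hχ.contDiffAt.comp s (Real.contDiffAt_sqrt (lt_of_lt_of_le (by positivity) hs).ne')

lemma iteratedDeriv_mul_one_add_sq (c ω : ℝ) (i : ℕ) (hi : 1 ≤ i) :
    iteratedDeriv i (fun ω : ℝ => c * (1 + ω ^ 2)) ω =
      if i = 1 then 2 * c * ω else if i = 2 then 2 * c else 0 := by
  have h1 : deriv (fun ω : ℝ => c * (1 + ω ^ 2)) = fun ω => 2 * c * ω := by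
    funext x
    have := (((hasDerivAt_pow 2 x).const_add 1).const_mul c).deriv
    rw [this]; push_cast; ring
  have h2 : deriv (fun ω : ℝ => 2 * c * ω) = fun _ => 2 * c := by
    funext x
    simp
  obtain _ | _ | k := i
  · omega
  · simp only [zero_add, iteratedDeriv_one, h1, if_true]
  · rw [iteratedDeriv_succ', h1, iteratedDeriv_succ', h2, iteratedDeriv_const]
    simp

lemma abs_le_sqrt_one_add_sq (ω : ℝ) : |ω| ≤ √(1 + ω ^ 2) :=
  Real.abs_le_sqrt (by linarith)

/-- Symbol bounds for the cutoff: `ω ↦ ψ (ρ² ⟨ω⟩²)` is a symbol of order `0`, uniformly in `ρ`,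
when `ψ` is smooth and constant near infinity. -/
lemma exists_norm_iteratedDeriv_comp_le {ψ : ℝ → ℝ} {δ : ℝ} {N : WithTop ℕ∞}
    (hψ : ContDiff ℝ N ψ) (hone : ∀ s, δ ^ 2 ≤ s → ψ s = 1) (hδ : 0 < δ) (j : ℕ) (hj : j ≤ N) :
    ∃ K, 0 ≤ K ∧ ∀ ρ > 0, ∀ ω : ℝ,
      ‖iteratedDeriv j (fun ω => ψ (ρ ^ 2 * (1 + ω ^ 2))) ω‖ ≤ K * (√(1 + ω ^ 2) ^ j)⁻¹ := by
  have hM : ∀ i : ℕ, ∃ M, i ≤ j → ∀ s ∈ Icc (0 : ℝ) (δ ^ 2), ‖iteratedDeriv i ψ s‖ ≤ M := by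
    intro i
    by_cases hi : i ≤ j
    · obtain ⟨M, hM⟩ := isCompact_Icc.exists_bound_of_continuousOn (s := Icc (0 : ℝ) (δ ^ 2))
        (hψ.continuous_iteratedDeriv i (le_trans (by exact_mod_cast hi) hj)).continuousOn
      exact ⟨M, fun _ => hM⟩
    · exact ⟨0, fun h => absurd h hi⟩
  choose M hM using hM
  set S := ∑ i ∈ Finset.range (j + 1), |M i|
  have hS : 0 ≤ S := Finset.sum_nonneg fun _ _ => abs_nonneg _
  set D := 1 + 2 * δ ^ 2 with hD
  have hD1 : 1 ≤ D := by rw [hD]; nlinarith [sq_nonneg δ]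
  refine ⟨j.factorial * S * D ^ j + 1, by positivity, fun ρ hρ ω => ?_⟩
  set b := √(1 + ω ^ 2) with hb
  have hb2 : b ^ 2 = 1 + ω ^ 2 := Real.sq_sqrt (by positivity)
  have hb0 : 0 < b := Real.sqrt_pos.2 (by positivity)
  have hωb : |ω| ≤ b := abs_le_sqrt_one_add_sq ω
  rcases le_or_gt (ρ ^ 2 * (1 + ω ^ 2)) (δ ^ 2) with h | h
  · have key := norm_iteratedFDeriv_comp_le (g := ψ) (f := fun ω : ℝ => ρ ^ 2 * (1 + ω ^ 2))
      (n := j) (N := N) hψ (by fun_prop) hj ω (C := S) (D := D / b) ?_ ?_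
    · rw [norm_iteratedFDeriv_eq_norm_iteratedDeriv] at key
      refine key.trans ?_
      rw [div_pow, ← mul_div_assoc, div_eq_mul_inv]
      gcongr
      linarith
    · intro i hi
      rw [norm_iteratedFDeriv_eq_norm_iteratedDeriv]
      refine (hM i hi _ ⟨by positivity, h⟩).trans ((le_abs_self _).trans ?_)
      exact Finset.single_le_sum (f := fun i => |M i|) (fun _ _ => abs_nonneg _)
        (Finset.mem_range.2 (by omega))
    · intro i hi _
      rw [norm_iteratedFDeriv_eq_norm_iteratedDeriv, iteratedDeriv_mul_one_add_sq _ _ _ hi]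
      rw [← hb2] at h
      split_ifs with h1 h2
      · subst h1
        rw [pow_one, le_div_iff₀ hb0, Real.norm_eq_abs, abs_mul, abs_of_pos (by positivity)]
        calc 2 * ρ ^ 2 * |ω| * b ≤ 2 * ρ ^ 2 * b * b := by gcongr
          _ ≤ D := by rw [hD]; nlinarith
      · subst h2
        rw [div_pow, le_div_iff₀ (by positivity), Real.norm_eq_abs, abs_of_pos (by positivity)]
        calc 2 * ρ ^ 2 * b ^ 2 ≤ D := by rw [hD]; nlinarith
          _ ≤ D ^ 2 := by nlinarith
      · rw [norm_zero]; positivity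
  · have hev : (fun ω => ψ (ρ ^ 2 * (1 + ω ^ 2))) =ᶠ[nhds ω] fun _ => (1 : ℝ) := by
      have hcont : Continuous fun ω : ℝ => ρ ^ 2 * (1 + ω ^ 2) := by fun_prop
      filter_upwards [hcont.continuousAt.eventually (lt_mem_nhds h)] with x hx
      exact hone _ hx.le
    rw [hev.iteratedDeriv_eq, iteratedDeriv_const]
    split_ifs with h0
    · subst h0
      simpa using by positivity
    · rw [norm_zero]; positivity

/-- Leibniz rule for symbols of order `0` and `-n`. -/
lemma norm_iteratedDeriv_smul_le_symbol {h : ℝ → ℝ} {f : ℝ → ℂ} {n j : ℕ} {K : ℕ → ℝ} {C b ω : ℝ}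
    {N : WithTop ℕ∞} (hh : ContDiff ℝ N h) (hf : ContDiff ℝ N f) (hj : j ≤ N)
    (hhb : ∀ i ≤ j, ‖iteratedDeriv i h ω‖ ≤ K i * (b ^ i)⁻¹)
    (hfb : ∀ i ≤ j, ‖iteratedDeriv i f ω‖ ≤ C * (b ^ (n + i))⁻¹) :
    ‖iteratedDeriv j (fun x => h x • f x) ω‖ ≤
      (∑ i ∈ Finset.range (j + 1), j.choose i * K i * C) * (b ^ (n + j))⁻¹ := by
  have key := norm_iteratedFDeriv_smul_le hh hf ω hj
  simp only [norm_iteratedFDeriv_eq_norm_iteratedDeriv] at key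
  refine key.trans ?_
  rw [Finset.sum_mul]
  refine Finset.sum_le_sum fun i hi => ?_
  have hij : i ≤ j := by simpa [Nat.lt_succ_iff] using hi
  have h1 := hhb i hij
  have h2 := hfb (j - i) (Nat.sub_le _ _)
  calc (j.choose i : ℝ) * ‖iteratedDeriv i h ω‖ * ‖iteratedDeriv (j - i) f ω‖
      ≤ j.choose i * (K i * (b ^ i)⁻¹) * (C * (b ^ (n + (j - i)))⁻¹) := by
        have := (norm_nonneg _).trans h1
        gcongr
    _ = j.choose i * K i * C * (b ^ (n + j))⁻¹ := by
        have : b ^ (n + j) = b ^ i * b ^ (n + (j - i)) := by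
          rw [← pow_add]; congr 1; omega
        rw [this, mul_inv]; ring

/-- On the region `δ ≤ ρ⟨ω⟩`, the factor `ρ⁻ⁿ` is absorbed by the decay of order `n + j`. -/
lemma inv_pow_mul_inv_pow_le {δ ρ ω : ℝ} {n j : ℕ} (hδ : 0 < δ) (hρ : 0 < ρ) (hn : 2 ≤ n)
    (h : δ ≤ ρ * √(1 + ω ^ 2)) :
    (ρ ^ n)⁻¹ * (√(1 + ω ^ 2) ^ (n + j))⁻¹ ≤
      (δ ^ (n - 2 + j))⁻¹ * (1 + (δ ^ 2)⁻¹) * (ρ ^ j * (1 + (ρ * ω) ^ 2)⁻¹) := by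
  set b := √(1 + ω ^ 2) with hb
  have hb2 : b ^ 2 = 1 + ω ^ 2 := Real.sq_sqrt (by positivity)
  have hb0 : 0 < b := Real.sqrt_pos.2 (by positivity)
  have hpow : ρ ^ n * b ^ (n + j) * ρ ^ j = (ρ * b) ^ (n - 2 + j) * (ρ * b) ^ 2 := by
    rw [← pow_add, show n - 2 + j + 2 = n + j by omega, mul_pow, pow_add ρ]; ring
  have hsq : ((ρ * b) ^ 2)⁻¹ ≤ (1 + (δ ^ 2)⁻¹) * (1 + (ρ * ω) ^ 2)⁻¹ := by
    rw [← div_eq_mul_inv, le_div_iff₀ (by positivity), inv_mul_le_iff₀ (by positivity)]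
    have h1 : δ ^ 2 ≤ (ρ * b) ^ 2 := by gcongr
    have h2 : 1 ≤ (ρ * b) ^ 2 * (δ ^ 2)⁻¹ := by
      rw [← div_eq_mul_inv, le_div_iff₀ (by positivity)]; linarith
    have h3 : (ρ * ω) ^ 2 ≤ (ρ * b) ^ 2 := by
      rw [mul_pow, mul_pow, hb2]; nlinarith [sq_pos_of_pos hρ]
    linarith
  calc (ρ ^ n)⁻¹ * (b ^ (n + j))⁻¹ = ρ ^ j * (ρ ^ n * b ^ (n + j) * ρ ^ j)⁻¹ := by
        field_simp
    _ = ρ ^ j * (((ρ * b) ^ (n - 2 + j))⁻¹ * ((ρ * b) ^ 2)⁻¹) := by rw [hpow, mul_inv]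
    _ ≤ ρ ^ j * ((δ ^ (n - 2 + j))⁻¹ * ((1 + (δ ^ 2)⁻¹) * (1 + (ρ * ω) ^ 2)⁻¹)) := by
        gcongr
    _ = _ := by ring

lemma integrable_inv_one_add_mul_sq {ρ : ℝ} (hρ : 0 < ρ) :
    Integrable fun ω : ℝ => (1 + (ρ * ω) ^ 2)⁻¹ :=
  integrable_inv_one_add_sq.comp_mul_left' hρ.ne'

lemma integral_inv_one_add_mul_sq {ρ : ℝ} (hρ : 0 < ρ) :
    ∫ ω : ℝ, (1 + (ρ * ω) ^ 2)⁻¹ = ρ⁻¹ * Real.pi := by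
  rw [Measure.integral_comp_mul_left (fun x => (1 + x ^ 2)⁻¹) ρ, integral_univ_inv_one_add_sq,
    abs_of_pos (by positivity), smul_eq_mul]

lemma norm_exp_I_mul_mul (a ω : ℝ) : ‖Complex.exp (Complex.I * (a : ℂ) * (ω : ℂ))‖ = 1 := by
  rw [show Complex.I * (a : ℂ) * (ω : ℂ) = ((a * ω : ℝ) : ℂ) * Complex.I by push_cast; ring,
    Complex.norm_exp_ofReal_mul_I]

lemma integrable_exp_mul {G : ℝ → ℂ} (hG : Integrable G) (a : ℝ) :
    Integrable fun ω : ℝ => Complex.exp (Complex.I * (a : ℂ) * (ω : ℂ)) * G ω :=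
  hG.bdd_mul (c := 1) (by fun_prop : Continuous _).aestronglyMeasurable
    (Filter.Eventually.of_forall fun ω => (norm_exp_I_mul_mul a ω).le)

/-- Repeated integration by parts against `e^{iaω}`. -/
lemma integral_exp_mul_iteratedDeriv {G : ℝ → ℂ} {N : ℕ} (hG : ContDiff ℝ N G) (a : ℝ)
    (hint : ∀ j ≤ N, Integrable (iteratedDeriv j G)) (k : ℕ) (hk : k ≤ N) :
    ∫ ω : ℝ, Complex.exp (Complex.I * (a : ℂ) * (ω : ℂ)) * iteratedDeriv k G ω =
      (-(Complex.I * a)) ^ k * ∫ ω : ℝ, Complex.exp (Complex.I * (a : ℂ) * (ω : ℂ)) * G ω := by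
  induction k with
  | zero => simp
  | succ k ih =>
    have hu : ∀ x : ℝ, HasDerivAt (fun ω : ℝ => Complex.exp (Complex.I * (a : ℂ) * (ω : ℂ)))
        (Complex.I * a * Complex.exp (Complex.I * (a : ℂ) * (x : ℂ))) x := by
      intro x
      have := ((Complex.ofRealCLM.hasDerivAt (x := x)).const_mul (Complex.I * (a : ℂ))).cexp
      simpa [mul_comm] using this
    have hv : ∀ x : ℝ, HasDerivAt (iteratedDeriv k G) (iteratedDeriv (k + 1) G x) x := by
      intro x
      rw [iteratedDeriv_succ]
      exact (hG.differentiable_iteratedDeriv k (by exact_mod_cast hk)).differentiableAt.hasDerivAt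
    have h0 := integrable_exp_mul (hint k (by omega)) a
    rw [integral_mul_deriv_eq_deriv_mul_of_integrable (fun x _ => hu x) (fun x _ => hv x)
      (integrable_exp_mul (hint (k + 1) hk) a) ?_ h0]
    · simp only [mul_assoc (Complex.I * (a : ℂ))]
      rw [integral_const_mul, ih (by omega), pow_succ]
      ring
    · have := h0.const_mul (Complex.I * (a : ℂ))
      exact this.congr (Filter.Eventually.of_forall fun x => by simp [mul_assoc])

/-- The amplitude `(1 - χ(ρ⟨ω⟩)) f(ω)`: derivative bounds after multiplication by `ρ⁻ⁿ`. -/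
lemma exists_norm_iteratedDeriv_amplitude_le
    {ψ : ℝ → ℝ} {δ₁ δ₀ : ℝ} {N : WithTop ℕ∞} (hδ₁ : 0 < δ₁) (hδ₀ : 0 < δ₀)
    (hψ : ContDiff ℝ N ψ) (hzero : ∀ s, s ≤ δ₁ ^ 2 → ψ s = 0) (hone : ∀ s, δ₀ ^ 2 ≤ s → ψ s = 1)
    {n : ℕ} (hn : 2 ≤ n) {C : ℝ} (hC : 0 < C) (j : ℕ) (hj : j ≤ N) :
    ∃ A, 0 ≤ A ∧ ∀ f : ℝ → ℂ, ContDiff ℝ N f →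
      (∀ i ≤ j, ∀ ω : ℝ, ‖iteratedDeriv i f ω‖ ≤ C * (√(1 + ω ^ 2) ^ (n + i))⁻¹) →
      ∀ ρ > 0, ∀ ω : ℝ, ‖iteratedDeriv j (fun ω => ψ (ρ ^ 2 * (1 + ω ^ 2)) • f ω) ω‖ ≤
        ρ ^ n * (A * (ρ ^ j * (1 + (ρ * ω) ^ 2)⁻¹)) := by
  have hK : ∀ i : ℕ, ∃ K, 0 ≤ K ∧ (i ≤ j → ∀ ρ > 0, ∀ ω : ℝ,
      ‖iteratedDeriv i (fun ω => ψ (ρ ^ 2 * (1 + ω ^ 2))) ω‖ ≤ K * (√(1 + ω ^ 2) ^ i)⁻¹) := by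
    intro i
    by_cases hi : i ≤ j
    · obtain ⟨K, hK0, hK⟩ := exists_norm_iteratedDeriv_comp_le hψ hone hδ₀ i
        (le_trans (by exact_mod_cast hi) hj)
      exact ⟨K, hK0, fun _ => hK⟩
    · exact ⟨0, le_rfl, fun h => absurd h hi⟩
  choose K hK0 hK using hK
  set S := ∑ i ∈ Finset.range (j + 1), j.choose i * K i * C
  have hS : 0 ≤ S := Finset.sum_nonneg fun i _ => by have := hK0 i; positivity
  refine ⟨S * ((δ₁ ^ (n - 2 + j))⁻¹ * (1 + (δ₁ ^ 2)⁻¹)), by positivity, fun f hf hfb ρ hρ ω => ?_⟩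
  have hb0 : 0 < √(1 + ω ^ 2) := Real.sqrt_pos.2 (by positivity)
  rcases le_or_gt δ₁ (ρ * √(1 + ω ^ 2)) with h | h
  · have hψq : ContDiff ℝ N fun ω : ℝ => ψ (ρ ^ 2 * (1 + ω ^ 2)) := hψ.comp (by fun_prop)
    refine (norm_iteratedDeriv_smul_le_symbol hψq hf hj
      (fun i hi => hK i hi ρ hρ ω) fun i hi => hfb i hi ω).trans ?_
    calc S * (√(1 + ω ^ 2) ^ (n + j))⁻¹
        = ρ ^ n * (S * ((ρ ^ n)⁻¹ * (√(1 + ω ^ 2) ^ (n + j))⁻¹)) := by field_simp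
      _ ≤ ρ ^ n * (S * ((δ₁ ^ (n - 2 + j))⁻¹ * (1 + (δ₁ ^ 2)⁻¹) *
            (ρ ^ j * (1 + (ρ * ω) ^ 2)⁻¹))) := by
          gcongr ρ ^ n * (S * ?_)
          exact inv_pow_mul_inv_pow_le hδ₁ hρ hn h
      _ = _ := by ring
  · have hev : (fun ω => ψ (ρ ^ 2 * (1 + ω ^ 2)) • f ω) =ᶠ[nhds ω] fun _ => (0 : ℂ) := by
      have hcont : Continuous fun ω : ℝ => ρ * √(1 + ω ^ 2) := by fun_prop
      filter_upwards [hcont.continuousAt.eventually (gt_mem_nhds h)] with x hx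
      have hx2 : ρ ^ 2 * (1 + x ^ 2) ≤ δ₁ ^ 2 := by
        rw [← Real.sq_sqrt (show 0 ≤ 1 + x ^ 2 by positivity), ← mul_pow]
        exact pow_le_pow_left₀ (by positivity) hx.le 2
      rw [hzero _ hx2, zero_smul]
    rw [hev.iteratedDeriv_eq, iteratedDeriv_const, ite_self, norm_zero]
    positivity

/-- Non-oscillatory kernel bound with cutoff and gain of `|a|⁻¹`: for a smooth
cutoff `χ` (`= 1` on `|x| ≤ δ₁`, `= 0` on `|x| ≥ δ₀`), `n ≥ 2`, and `f` with
`|f⁽ʲ⁾(ω)| ≤ C⟨ω⟩^{-n-j}` for `j = 0,1,2,3`, one has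
`|ρ^{-n} ∫_ℝ (1-χ(ρ⟨ω⟩)) e^{iaω} f(ω) dω| ≤ C'|a|^{-1}⟨a⟩^{-2}` for all
`ρ ∈ (0,1)`, `a ≠ 0`, with `C'` depending only on `χ`, `n`, `C`. -/
theorem cutoff_kernel_bound_gain
    (δ₁ δ₀ : ℝ) (hδ₁ : 0 < δ₁) (hδ : δ₁ < δ₀) (χ : ℝ → ℝ)
    (hχsmooth : ContDiff ℝ (⊤ : ℕ∞) χ) (hχrange : ∀ x : ℝ, χ x ∈ Icc (0:ℝ) 1)
    (hχone : ∀ x : ℝ, |x| ≤ δ₁ → χ x = 1) (hχzero : ∀ x : ℝ, δ₀ ≤ |x| → χ x = 0)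
    (n : ℕ) (hn : 2 ≤ n) (C : ℝ) (hC : 0 < C) :
    ∃ C' > (0:ℝ), ∀ f : ℝ → ℂ, ContDiff ℝ 3 f →
      (∀ j : ℕ, j ≤ 3 → ∀ ω : ℝ,
        ‖iteratedDeriv j f ω‖ ≤ C * Real.sqrt (1 + ω^2) ^ (-(n:ℝ) - (j:ℝ))) →
      ∀ ρ ∈ Ioo (0:ℝ) 1, ∀ a : ℝ, a ≠ 0 →
        ‖((ρ:ℂ)^n)⁻¹ * ∫ ω : ℝ,
            ((1 - χ (ρ * Real.sqrt (1 + ω^2)) : ℝ) : ℂ)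
              * Complex.exp (Complex.I * (a:ℂ) * (ω:ℂ)) * f ω‖
          ≤ C' * |a|⁻¹ * Real.sqrt (1 + a^2) ^ (-(2:ℝ)) := by
  have hδ₀ : 0 < δ₀ := hδ₁.trans hδ
  set ψ : ℝ → ℝ := fun s => 1 - χ (√s) with hψdef
  have hψ : ContDiff ℝ 3 ψ := contDiff_const.sub
    (contDiff_comp_sqrt_of_eq_one hδ₁ (contDiff_infty.1 hχsmooth 3) hχone)
  have hψ0 : ∀ s, s ≤ δ₁ ^ 2 → ψ s = 0 := by
    intro s hs
    rw [hψdef]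
    simp only
    rw [hχone _ (by rw [abs_of_nonneg (Real.sqrt_nonneg _)]
                    exact (Real.sqrt_le_left hδ₁.le).2 hs), sub_self]
  have hψ1 : ∀ s, δ₀ ^ 2 ≤ s → ψ s = 1 := by
    intro s hs
    rw [hψdef]
    simp only
    rw [hχzero _ (by rw [abs_of_nonneg (Real.sqrt_nonneg _)]
                     exact Real.le_sqrt_of_sq_le hs), sub_zero]
  have hA : ∀ j : ℕ, ∃ A, 0 ≤ A ∧ (j ≤ 3 → ∀ f : ℝ → ℂ, ContDiff ℝ 3 f →
      (∀ i ≤ j, ∀ ω : ℝ, ‖iteratedDeriv i f ω‖ ≤ C * (√(1 + ω ^ 2) ^ (n + i))⁻¹) →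
      ∀ ρ > 0, ∀ ω : ℝ, ‖iteratedDeriv j (fun ω => ψ (ρ ^ 2 * (1 + ω ^ 2)) • f ω) ω‖ ≤
        ρ ^ n * (A * (ρ ^ j * (1 + (ρ * ω) ^ 2)⁻¹))) := by
    intro j
    by_cases hj : j ≤ 3
    · obtain ⟨A, hA0, hA⟩ := exists_norm_iteratedDeriv_amplitude_le hδ₁ hδ₀ hψ hψ0 hψ1 hn hC j
        (by exact_mod_cast hj)
      exact ⟨A, hA0, fun _ => hA⟩
    · exact ⟨0, le_rfl, fun h => absurd h hj⟩
  choose A hA0 hA using hA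
  have hA1 := hA0 1
  have hA3 := hA0 3
  refine ⟨(A 1 + A 3) * Real.pi + 1, by positivity, fun f hf hfb ρ hρ a ha => ?_⟩
  obtain ⟨hρ0, hρ1⟩ := hρ
  have hfb' : ∀ i ≤ 3, ∀ ω : ℝ, ‖iteratedDeriv i f ω‖ ≤ C * (√(1 + ω ^ 2) ^ (n + i))⁻¹ := by
    intro i hi ω
    refine (hfb i hi ω).trans_eq ?_
    rw [show -(n : ℝ) - (i : ℝ) = -((n + i : ℕ) : ℝ) by push_cast; ring,
      Real.rpow_neg (Real.sqrt_nonneg _), Real.rpow_natCast]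
  set G : ℝ → ℂ := fun ω => ψ (ρ ^ 2 * (1 + ω ^ 2)) • f ω with hGdef
  have hGsmooth : ContDiff ℝ (3 : ℕ) G := by
    have hψq : ContDiff ℝ 3 fun ω : ℝ => ψ (ρ ^ 2 * (1 + ω ^ 2)) := hψ.comp (by fun_prop)
    exact_mod_cast hψq.smul hf
  have hGb : ∀ j ≤ 3, ∀ ω, ‖iteratedDeriv j G ω‖ ≤
      ρ ^ n * (A j * (ρ ^ j * (1 + (ρ * ω) ^ 2)⁻¹)) := fun j hj =>
    hA j hj f hf (fun i hi => hfb' i (hi.trans hj)) ρ hρ0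
  have hdom : ∀ j : ℕ, Integrable fun ω : ℝ => ρ ^ n * (A j * (ρ ^ j * (1 + (ρ * ω) ^ 2)⁻¹)) :=
    fun j => (((integrable_inv_one_add_mul_sq hρ0).const_mul _).const_mul _).const_mul _
  have hGint : ∀ j ≤ 3, Integrable (iteratedDeriv j G) := fun j hj =>
    (hdom j).mono' (hGsmooth.continuous_iteratedDeriv j (by exact_mod_cast hj)).aestronglyMeasurable
      (Filter.Eventually.of_forall (hGb j hj))
  set J : ℂ := ∫ ω : ℝ, Complex.exp (Complex.I * (a : ℂ) * (ω : ℂ)) * G ω with hJ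
  have hJeq : ∫ ω : ℝ, ((1 - χ (ρ * Real.sqrt (1 + ω^2)) : ℝ) : ℂ)
      * Complex.exp (Complex.I * (a:ℂ) * (ω:ℂ)) * f ω = J := by
    refine integral_congr_ae (Filter.Eventually.of_forall fun ω => ?_)
    simp only [hGdef, hψdef]
    rw [Real.sqrt_mul (by positivity), Real.sqrt_sq hρ0.le, Complex.real_smul]
    ring
  have hmain : ∀ k, 1 ≤ k → k ≤ 3 → |a| ^ k * ((ρ ^ n)⁻¹ * ‖J‖) ≤ A k * Real.pi := by
    intro k hk1 hk
    have h1 : |a| ^ k * ‖J‖ ≤ ∫ ω : ℝ, ρ ^ n * (A k * (ρ ^ k * (1 + (ρ * ω) ^ 2)⁻¹)) := by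
      have h2 := congrArg norm (integral_exp_mul_iteratedDeriv hGsmooth a hGint k hk)
      rw [norm_mul, norm_pow, norm_neg, norm_mul, Complex.norm_I, one_mul, Complex.norm_real,
        Real.norm_eq_abs] at h2
      rw [hJ, ← h2]
      refine norm_integral_le_of_norm_le (hdom k) (Filter.Eventually.of_forall fun ω => ?_)
      rw [norm_mul, norm_exp_I_mul_mul, one_mul]
      exact hGb k hk ω
    rw [integral_const_mul, integral_const_mul, integral_const_mul,
      integral_inv_one_add_mul_sq hρ0] at h1
    have h3 : ρ ^ k * (ρ⁻¹ * Real.pi) ≤ Real.pi := by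
      rw [← mul_assoc]
      refine mul_le_of_le_one_left Real.pi_pos.le ?_
      rw [← div_eq_mul_inv, div_le_one hρ0]
      simpa using pow_le_pow_of_le_one hρ0.le hρ1.le hk1
    calc |a| ^ k * ((ρ ^ n)⁻¹ * ‖J‖) = (ρ ^ n)⁻¹ * (|a| ^ k * ‖J‖) := by ring
      _ ≤ (ρ ^ n)⁻¹ * (ρ ^ n * (A k * (ρ ^ k * (ρ⁻¹ * Real.pi)))) := by gcongr
      _ = A k * (ρ ^ k * (ρ⁻¹ * Real.pi)) := by field_simp
      _ ≤ A k * Real.pi := by have := hA0 k; gcongr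
  have h1 := hmain 1 le_rfl (by norm_num)
  have h3 := hmain 3 (by norm_num) le_rfl
  have ha0 : 0 < |a| := abs_pos.2 ha
  rw [hJeq, norm_mul, norm_inv, norm_pow, Complex.norm_real, Real.norm_of_nonneg hρ0.le,
    Real.rpow_neg (Real.sqrt_nonneg _), Real.rpow_two, Real.sq_sqrt (by positivity), mul_assoc,
    ← mul_inv, ← div_eq_mul_inv, le_div_iff₀ (by positivity), ← sq_abs a]
  linear_combination h1 + h3
end

section
/- Let C₁, C₂ > 0 and let f : [0, 1/4) × ℝ → ℂ be a C¹ function such that for every fixed ε ∈ [0, 1/4) the map ω ↦ f(ε, ω) is odd, and such that |f(ε, ω)| ≤ C₁ ⟨ω⟩^{−1} and |∂_ω f(ε, ω)| ≤ C₂ ⟨ω⟩^{−2} for all (ε, ω). Then for every a ∈ ℝ \ {0} the improper integrals lim_{N→∞} ∫_{−N}^{N} e^{i a ω} f(ε, ω) dω exist for all ε ∈ [0, 1/4), and lim_{ε→0⁺} ∫_ℝ e^{i a ω} f(ε, ω) dω = ∫_ℝ e^{i a ω} f(0, ω) dω. -/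
open MeasureTheory Filter Set

/-- The partial derivative in the second variable of a function that is `C¹` on `s ×ˢ univ`
is jointly continuous there. -/
theorem ContDiffOn.continuousOn_partial_deriv_snd {s : Set ℝ} (hs : UniqueDiffOn ℝ s)
    {f f' : ℝ → ℝ → ℂ} (hf : ContDiffOn ℝ 1 (fun p : ℝ × ℝ => f p.1 p.2) (s ×ˢ univ))
    (hderiv : ∀ x ∈ s, ∀ y, HasDerivAt (f x) (f' x y) y) :
    ContinuousOn (fun p : ℝ × ℝ => f' p.1 p.2) (s ×ˢ univ) := by
  have hcont := hf.continuousOn_fderivWithin (hs.prod uniqueDiffOn_univ) le_rfl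
  refine (hcont.clm_apply (continuousOn_const (c := ((0 : ℝ), (1 : ℝ))))).congr ?_
  rintro ⟨x, y⟩ hxy
  have hF := (hf.differentiableOn one_ne_zero (x, y) hxy).hasFDerivWithinAt
  have hline : HasDerivWithinAt (fun t : ℝ => (x, t)) ((0 : ℝ), (1 : ℝ)) univ y :=
    ((hasDerivAt_const y x).prodMk (hasDerivAt_id y)).hasDerivWithinAt
  have hcomp := hF.comp_hasDerivWithinAt y hline (fun t _ => ⟨hxy.1, mem_univ t⟩)
  exact (hderiv x hxy.1 y).unique (hasDerivWithinAt_univ.mp hcomp)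

theorem Real.tendsto_sqrt_one_add_sq_rpow_neg_one {l : Filter ℝ}
    (hl : Tendsto (fun x : ℝ => |x|) l atTop) :
    Tendsto (fun x : ℝ => √(1 + x ^ 2) ^ (-(1 : ℝ))) l (nhds 0) := by
  refine (tendsto_rpow_neg_atTop one_pos).comp (tendsto_atTop_mono (fun x => ?_) hl)
  exact Real.abs_le_sqrt (by linarith)

theorem Real.sqrt_one_add_sq_rpow_neg_two (x : ℝ) :
    √(1 + x ^ 2) ^ (-(2 : ℝ)) = (1 + x ^ 2)⁻¹ := by
  rw [Real.rpow_neg (Real.sqrt_nonneg _), Real.rpow_two, Real.sq_sqrt (by positivity)]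

theorem Complex.norm_exp_I_mul_ofReal_mul_ofReal (a x : ℝ) :
    ‖Complex.exp (Complex.I * a * x)‖ = 1 := by
  rw [mul_assoc, ← Complex.ofReal_mul, Complex.norm_exp_I_mul_ofReal]

/-- Integration by parts for a convergent oscillatory integral: if `g` vanishes at `±∞` and has an
integrable derivative, the symmetric improper integral of `e^{iax} g(x)` exists. -/
theorem tendsto_intervalIntegral_exp_mul_of_integrable_deriv {g g' : ℝ → ℂ} {a : ℝ} (ha : a ≠ 0)
    (hg : ∀ x, HasDerivAt g (g' x) x) (hg' : Integrable g')
    (htop : Tendsto g atTop (nhds 0)) (hbot : Tendsto g atBot (nhds 0)) :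
    Tendsto (fun N : ℝ => ∫ x in (-N)..N, Complex.exp (Complex.I * a * x) * g x) atTop
      (nhds (-∫ x, g' x * (Complex.exp (Complex.I * a * x) / (Complex.I * a)))) := by
  set c : ℂ := Complex.I * a with hc
  have hc0 : c ≠ 0 := mul_ne_zero Complex.I_ne_zero (Complex.ofReal_ne_zero.mpr ha)
  set v : ℝ → ℂ := fun x => Complex.exp (c * x) / c with hv
  have hv_deriv : ∀ x : ℝ, HasDerivAt v (Complex.exp (c * x)) x := by
    intro x
    have h := (((hasDerivAt_id x).ofReal_comp.const_mul c).cexp).div_const c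
    simpa [hc0] using h
  have hexp : Continuous fun x : ℝ => Complex.exp (c * x) := by fun_prop
  have hv_cont : Continuous v := hexp.div_const c
  have hv_norm : ∀ x, ‖v x‖ = ‖c‖⁻¹ := fun x => by
    simp only [hv, hc, norm_div, Complex.norm_exp_I_mul_ofReal_mul_ofReal, one_div]
  have hintegrable : Integrable fun x => g' x * v x :=
    hg'.mul_bdd (c := ‖c‖⁻¹) hv_cont.aestronglyMeasurable (ae_of_all _ fun x => (hv_norm x).le)
  have hboundary : ∀ {l : Filter ℝ}, Tendsto g l (nhds 0) →
      Tendsto (fun x => g x * v x) l (nhds 0) := by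
    intro l hl
    rw [tendsto_zero_iff_norm_tendsto_zero] at hl ⊢
    simpa [hv_norm] using hl.mul_const ‖c‖⁻¹
  have hparts : ∀ N : ℝ, ∫ x in (-N)..N, Complex.exp (c * x) * g x =
      g N * v N - g (-N) * v (-N) - ∫ x in (-N)..N, g' x * v x := by
    intro N
    rw [← intervalIntegral.integral_mul_deriv_eq_deriv_mul (fun x _ => hg x)
      (fun x _ => hv_deriv x) hg'.intervalIntegrable (hexp.intervalIntegrable _ _)]
    simp only [mul_comm]
  simp only [hparts]
  have hlim := ((hboundary htop).sub ((hboundary hbot).comp tendsto_neg_atTop_atBot)).sub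
    (intervalIntegral_tendsto_integral hintegrable tendsto_neg_atTop_atBot tendsto_id)
  simpa using hlim

/-- Interchange of `ε → 0⁺` with a non-absolutely-convergent oscillatory integral:
if `f : [0,1/4) × ℝ → ℂ` is `C¹`, odd in `ω`, with `|f(ε,ω)| ≤ C₁⟨ω⟩⁻¹` and
`|∂_ω f(ε,ω)| ≤ C₂⟨ω⟩⁻²` uniformly in `ε`, then for every `a ≠ 0` the improper
integrals `I(ε) = ∫_ℝ e^{iaω} f(ε,ω) dω` exist and `I(ε) → I(0)` as `ε → 0⁺`. -/
theorem limit_interchange_oscillatory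
    (C₁ C₂ : ℝ) (hC₁ : 0 < C₁) (hC₂ : 0 < C₂) (f fω : ℝ → ℝ → ℂ)
    (hf : ContDiffOn ℝ 1 (fun p : ℝ × ℝ => f p.1 p.2) (Ico (0:ℝ) (1/4) ×ˢ univ))
    (hderiv : ∀ ε ∈ Ico (0:ℝ) (1/4), ∀ ω : ℝ, HasDerivAt (f ε) (fω ε ω) ω)
    (hodd : ∀ ε ∈ Ico (0:ℝ) (1/4), ∀ ω : ℝ, f ε (-ω) = -f ε ω)
    (hb1 : ∀ ε ∈ Ico (0:ℝ) (1/4), ∀ ω : ℝ,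
      ‖f ε ω‖ ≤ C₁ * Real.sqrt (1 + ω^2) ^ (-(1:ℝ)))
    (hb2 : ∀ ε ∈ Ico (0:ℝ) (1/4), ∀ ω : ℝ,
      ‖fω ε ω‖ ≤ C₂ * Real.sqrt (1 + ω^2) ^ (-(2:ℝ)))
    (a : ℝ) (ha : a ≠ 0) :
    ∃ I : ℝ → ℂ,
      (∀ ε ∈ Ico (0:ℝ) (1/4),
        Tendsto (fun N : ℝ => ∫ ω in (-N)..N,
            Complex.exp (Complex.I * (a:ℂ) * (ω:ℂ)) * f ε ω)
          atTop (nhds (I ε))) ∧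
      Tendsto I (nhdsWithin 0 (Ioi 0)) (nhds (I 0)) := by
  have hcont := hf.continuousOn_partial_deriv_snd (uniqueDiffOn_Ico 0 (1 / 4)) hderiv
  have hbound : ∀ ε ∈ Ico (0 : ℝ) (1 / 4), ∀ ω, ‖fω ε ω‖ ≤ C₂ * (1 + ω ^ 2)⁻¹ := fun ε hε ω => by
    simpa only [Real.sqrt_one_add_sq_rpow_neg_two] using hb2 ε hε ω
  have hfω_cont : ∀ ε ∈ Ico (0 : ℝ) (1 / 4), Continuous (fω ε) := fun ε hε =>
    hcont.comp_continuous (by fun_prop : Continuous fun ω : ℝ => (ε, ω)) fun ω => ⟨hε, mem_univ ω⟩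
  have hdecay : ∀ ε ∈ Ico (0 : ℝ) (1 / 4), ∀ {l : Filter ℝ},
      Tendsto (fun ω : ℝ => |ω|) l atTop → Tendsto (f ε) l (nhds 0) := fun ε hε l hl =>
    squeeze_zero_norm (hb1 ε hε)
      (by simpa using (Real.tendsto_sqrt_one_add_sq_rpow_neg_one hl).const_mul C₁)
  have hmaj : Integrable fun ω : ℝ => C₂ * (1 + ω ^ 2)⁻¹ := integrable_inv_one_add_sq.const_mul C₂
  refine ⟨fun ε => -∫ ω, fω ε ω * (Complex.exp (Complex.I * a * ω) / (Complex.I * a)),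
    fun ε hε => ?_, ?_⟩
  · exact tendsto_intervalIntegral_exp_mul_of_integrable_deriv ha (hderiv ε hε)
      (hmaj.mono' (hfω_cont ε hε).aestronglyMeasurable (ae_of_all _ (hbound ε hε)))
      (hdecay ε hε tendsto_abs_atTop_atTop) (hdecay ε hε tendsto_abs_atBot_atTop)
  · have hmem : ∀ᶠ ε in nhdsWithin (0 : ℝ) (Ioi 0), ε ∈ Ico (0 : ℝ) (1 / 4) := by
      filter_upwards [Ioo_mem_nhdsGT (show (0 : ℝ) < 1 / 4 by norm_num)] with ε hε
      exact Ioo_subset_Ico_self hε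
    refine (tendsto_integral_filter_of_dominated_convergence
      (fun ω => C₂ * (1 + ω ^ 2)⁻¹ * ‖Complex.I * (a : ℂ)‖⁻¹) ?_ ?_
      (hmaj.mul_const _) (ae_of_all _ fun ω => ?_)).neg
    · filter_upwards [hmem] with ε hε
      exact ((hfω_cont ε hε).mul (by fun_prop)).aestronglyMeasurable
    · filter_upwards [hmem] with ε hε
      refine ae_of_all _ fun ω => ?_
      rw [norm_mul, norm_div, Complex.norm_exp_I_mul_ofReal_mul_ofReal, one_div]
      exact mul_le_mul_of_nonneg_right (hbound ε hε ω) (by positivity)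
    · have h0 : ((0 : ℝ), ω) ∈ Ico (0 : ℝ) (1 / 4) ×ˢ (univ : Set ℝ) :=
        ⟨by norm_num, mem_univ ω⟩
      have hline : Tendsto (fun ε : ℝ => (ε, ω)) (nhdsWithin 0 (Ioi 0))
          (nhdsWithin (0, ω) (Ico (0 : ℝ) (1 / 4) ×ˢ univ)) :=
        tendsto_nhdsWithin_iff.mpr
          ⟨((by fun_prop : Continuous fun ε : ℝ => (ε, ω)).tendsto 0).mono_left nhdsWithin_le_nhds,
            hmem.mono fun ε hε => ⟨hε, mem_univ ω⟩⟩
      exact ((hcont _ h0).tendsto.comp hline).mul_const _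
end
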